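/- Let A be a ring and let M, N, R be finite A-modules. Then P^R_{M,N} = a_M · a_N · g^R_{M,N}. More precisely, the group Aut_A(M) × Aut_A(N) acts freely on the set of short exact sequences 0 → N → R → M → 0 by (φ,ψ)·(a,b) := (a ∘ ψ⁻¹, φ ∘ b), and the map sending a sequence (a,b) to the submodule image(a) induces a bijection from the set of orbits onto the set of A-submodules L ⊆ R with L isomorphic to N and R/L isomorphic to M. -/

import Mathlib

/-- `autCard A M` is `a_M`, the number of `A`-module automorphisms of `M`. -/
noncomputable def autCard (A : Type) [Ring A] (M : Type) [AddCommGroup M] [Module A M] : ℕ :=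
  Nat.card (M ≃ₗ[A] M)

/-- `IsSES A ab` says that the pair `ab = (a, b)` constitutes a short exact sequence
`0 → N → R → M → 0`: `a` injective, `b` surjective, `range a = ker b`. -/
def IsSES (A : Type) [Ring A] {M N R : Type}
    [AddCommGroup M] [Module A M] [AddCommGroup N] [Module A N]
    [AddCommGroup R] [Module A R]
    (ab : (N →ₗ[A] R) × (R →ₗ[A] M)) : Prop :=
  Function.Injective ab.1 ∧ Function.Surjective ab.2 ∧
    LinearMap.range ab.1 = LinearMap.ker ab.2

/-- `hallP A M N R` is `P^R_{M,N}`, the number of short exact sequences `0 → N → R → M → 0`. -/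
noncomputable def hallP (A : Type) [Ring A] (M N R : Type)
    [AddCommGroup M] [Module A M] [AddCommGroup N] [Module A N]
    [AddCommGroup R] [Module A R] : ℕ :=
  Nat.card {ab : (N →ₗ[A] R) × (R →ₗ[A] M) // IsSES A ab}

/-- `hallG A M N R` is `g^R_{M,N}`, the number of `A`-submodules `L ⊆ R` with `L ≅ N` and
`R/L ≅ M`. -/
noncomputable def hallG (A : Type) [Ring A] (M N R : Type)
    [AddCommGroup M] [Module A M] [AddCommGroup N] [Module A N]
    [AddCommGroup R] [Module A R] : ℕ :=
  Nat.card {L : Submodule A R // Nonempty (↥L ≃ₗ[A] N) ∧ Nonempty ((R ⧸ L) ≃ₗ[A] M)}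

section IsSES

variable {A : Type} [Ring A] {M N R : Type}
  [AddCommGroup M] [Module A M] [AddCommGroup N] [Module A N] [AddCommGroup R] [Module A R]
  {ab ab' : (N →ₗ[A] R) × (R →ₗ[A] M)}

theorem LinearMap.range_comp_symm (f : N →ₗ[A] R) (ψ : N ≃ₗ[A] N) :
    LinearMap.range (f ∘ₗ ψ.symm.toLinearMap) = LinearMap.range f :=
  LinearMap.range_comp_of_range_eq_top f ψ.symm.range

theorem IsSES.comp_equiv (h : IsSES A ab) (φ : M ≃ₗ[A] M) (ψ : N ≃ₗ[A] N) :
    IsSES A (ab.1 ∘ₗ ψ.symm.toLinearMap, φ.toLinearMap ∘ₗ ab.2) := by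
  refine ⟨h.1.comp ψ.symm.injective, φ.surjective.comp h.2.1, ?_⟩
  rw [LinearMap.range_comp_symm, LinearEquiv.ker_comp, h.2.2]

theorem IsSES.nonempty_equiv (h : IsSES A ab) :
    Nonempty (↥(LinearMap.range ab.1) ≃ₗ[A] N) ∧
      Nonempty ((R ⧸ LinearMap.range ab.1) ≃ₗ[A] M) :=
  ⟨⟨(LinearEquiv.ofInjective ab.1 h.1).symm⟩,
    ⟨(Submodule.quotEquivOfEq _ _ h.2.2).trans (ab.2.quotKerEquivOfSurjective h.2.1)⟩⟩

theorem IsSES.exists_range_eq (L : Submodule A R) (hN : Nonempty (↥L ≃ₗ[A] N))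
    (hM : Nonempty ((R ⧸ L) ≃ₗ[A] M)) :
    ∃ ab : (N →ₗ[A] R) × (R →ₗ[A] M), IsSES A ab ∧ LinearMap.range ab.1 = L := by
  obtain ⟨e⟩ := hN
  obtain ⟨f⟩ := hM
  have hL : LinearMap.range (L.subtype ∘ₗ e.symm.toLinearMap) = L := by
    rw [LinearMap.range_comp_of_range_eq_top _ e.symm.range, Submodule.range_subtype]
  refine ⟨(L.subtype ∘ₗ e.symm.toLinearMap, f.toLinearMap ∘ₗ L.mkQ),
    ⟨L.injective_subtype.comp e.symm.injective, f.surjective.comp L.mkQ_surjective, ?_⟩, hL⟩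
  rw [hL, LinearEquiv.ker_comp, Submodule.ker_mkQ]

theorem IsSES.exists_equiv_of_range_eq (h : IsSES A ab) (h' : IsSES A ab')
    (hr : LinearMap.range ab.1 = LinearMap.range ab'.1) :
    ∃ (φ : M ≃ₗ[A] M) (ψ : N ≃ₗ[A] N),
      ab' = (ab.1 ∘ₗ ψ.symm.toLinearMap, φ.toLinearMap ∘ₗ ab.2) := by
  have hk : LinearMap.ker ab.2 = LinearMap.ker ab'.2 := by rw [← h.2.2, hr, h'.2.2]
  let ψ : N ≃ₗ[A] N := (LinearEquiv.ofInjective ab.1 h.1).trans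
    ((LinearEquiv.ofEq _ _ hr).trans (LinearEquiv.ofInjective ab'.1 h'.1).symm)
  let φ : M ≃ₗ[A] M := (ab.2.quotKerEquivOfSurjective h.2.1).symm.trans
    ((Submodule.quotEquivOfEq _ _ hk).trans (ab'.2.quotKerEquivOfSurjective h'.2.1))
  have hψ (n : N) : ab'.1 (ψ n) = ab.1 n :=
    congrArg Subtype.val ((LinearEquiv.ofInjective ab'.1 h'.1).apply_symm_apply
      (LinearEquiv.ofEq _ _ hr (LinearEquiv.ofInjective ab.1 h.1 n)))
  have hφ (r : R) : φ (ab.2 r) = ab'.2 r := by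
    have : (ab.2.quotKerEquivOfSurjective h.2.1).symm (ab.2 r) =
        Submodule.Quotient.mk r := (LinearEquiv.symm_apply_eq _).2 rfl
    simp only [φ, LinearEquiv.trans_apply, this]
    rfl
  refine ⟨φ, ψ, Prod.ext ?_ ?_⟩
  · ext n
    simpa using hψ (ψ.symm n)
  · ext r
    exact (hφ r).symm

theorem IsSES.range_eq_iff (h : IsSES A ab) (h' : IsSES A ab') :
    LinearMap.range ab.1 = LinearMap.range ab'.1 ↔
      ∃ (φ : M ≃ₗ[A] M) (ψ : N ≃ₗ[A] N),
        ab' = (ab.1 ∘ₗ ψ.symm.toLinearMap, φ.toLinearMap ∘ₗ ab.2) := by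
  refine ⟨h.exists_equiv_of_range_eq h', ?_⟩
  rintro ⟨φ, ψ, rfl⟩
  exact (LinearMap.range_comp_symm _ _).symm

theorem IsSES.comp_equiv_injective (h : IsSES A ab) {φ φ' : M ≃ₗ[A] M} {ψ ψ' : N ≃ₗ[A] N}
    (hψ : ab.1 ∘ₗ ψ.symm.toLinearMap = ab.1 ∘ₗ ψ'.symm.toLinearMap)
    (hφ : φ.toLinearMap ∘ₗ ab.2 = φ'.toLinearMap ∘ₗ ab.2) : φ = φ' ∧ ψ = ψ' := by
  constructor
  · ext m
    obtain ⟨r, rfl⟩ := h.2.1 m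
    exact LinearMap.congr_fun hφ r
  · have : ψ.symm = ψ'.symm := by
      ext n
      exact h.1 (LinearMap.congr_fun hψ n)
    rw [← ψ.symm_symm, this, ψ'.symm_symm]

variable (A M N R) in
theorem hallP_eq_mul : hallP A M N R = autCard A M * autCard A N * hallG A M N R := by
  choose s hs hsL using fun L : {L : Submodule A R //
      Nonempty (↥L ≃ₗ[A] N) ∧ Nonempty ((R ⧸ L) ≃ₗ[A] M)} =>
    IsSES.exists_range_eq L.1 L.2.1 L.2.2
  unfold hallP autCard hallG
  rw [← Nat.card_prod, ← Nat.card_prod]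
  symm
  refine Nat.card_eq_of_bijective (fun x =>
    ⟨((s x.2).1 ∘ₗ x.1.2.symm.toLinearMap, x.1.1.toLinearMap ∘ₗ (s x.2).2),
      (hs x.2).comp_equiv x.1.1 x.1.2⟩) ⟨?_, ?_⟩
  · rintro ⟨⟨φ, ψ⟩, L⟩ ⟨⟨φ', ψ'⟩, L'⟩ hx
    obtain ⟨h₁, h₂⟩ := Prod.ext_iff.1 (Subtype.ext_iff.1 hx)
    dsimp only at h₁ h₂
    obtain rfl : L = L' := by
      have := congrArg LinearMap.range h₁
      rw [LinearMap.range_comp_symm, LinearMap.range_comp_symm, hsL, hsL] at this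
      exact Subtype.ext this
    obtain ⟨rfl, rfl⟩ := (hs L).comp_equiv_injective h₁ h₂
    rfl
  · rintro ⟨ab, h⟩
    obtain ⟨φ, ψ, e⟩ := (hs ⟨_, h.nonempty_equiv⟩).exists_equiv_of_range_eq h (hsL _)
    exact ⟨((φ, ψ), ⟨_, h.nonempty_equiv⟩), Subtype.ext e.symm⟩

end IsSES

/-- `P^R_{M,N} = a_M · a_N · g^R_{M,N}`.  More precisely: the group `Aut(M) × Aut(N)` acts
freely on the set of short exact sequences `0 → N → R → M → 0` via
`(φ,ψ)·(a,b) = (a ∘ ψ⁻¹, φ ∘ b)`, and the map `(a,b) ↦ image a` induces a bijection from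
the set of orbits onto the set of submodules `L ⊆ R` with `L ≅ N` and `R/L ≅ M`. -/
theorem hallP_eq_aut_mul_aut_mul_hallG
    (A : Type) [Ring A]
    (M N R : Type)
    [AddCommGroup M] [Module A M] [Finite M]
    [AddCommGroup N] [Module A N] [Finite N]
    [AddCommGroup R] [Module A R] [Finite R] :
    -- the counting identity
    (hallP A M N R = autCard A M * autCard A N * hallG A M N R) ∧
    -- the action of `Aut(M) × Aut(N)` is free
    (∀ ab : (N →ₗ[A] R) × (R →ₗ[A] M), IsSES A ab →
      ∀ (φ : M ≃ₗ[A] M) (ψ : N ≃ₗ[A] N),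
        ab.1 ∘ₗ ψ.symm.toLinearMap = ab.1 → φ.toLinearMap ∘ₗ ab.2 = ab.2 →
          φ = LinearEquiv.refl A M ∧ ψ = LinearEquiv.refl A N) ∧
    -- the action preserves the set of short exact sequences
    (∀ ab : (N →ₗ[A] R) × (R →ₗ[A] M), IsSES A ab →
      ∀ (φ : M ≃ₗ[A] M) (ψ : N ≃ₗ[A] N),
        IsSES A (ab.1 ∘ₗ ψ.symm.toLinearMap, φ.toLinearMap ∘ₗ ab.2)) ∧
    -- `(a,b) ↦ image a` lands in the prescribed set of submodules
    (∀ ab : (N →ₗ[A] R) × (R →ₗ[A] M), IsSES A ab →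
      Nonempty (↥(LinearMap.range ab.1) ≃ₗ[A] N) ∧
        Nonempty ((R ⧸ LinearMap.range ab.1) ≃ₗ[A] M)) ∧
    -- it is surjective onto that set of submodules
    (∀ L : Submodule A R, Nonempty (↥L ≃ₗ[A] N) → Nonempty ((R ⧸ L) ≃ₗ[A] M) →
      ∃ ab : (N →ₗ[A] R) × (R →ₗ[A] M), IsSES A ab ∧ LinearMap.range ab.1 = L) ∧
    -- and its fibres are exactly the orbits of the action
    (∀ ab ab' : (N →ₗ[A] R) × (R →ₗ[A] M), IsSES A ab → IsSES A ab' →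
      (LinearMap.range ab.1 = LinearMap.range ab'.1 ↔
        ∃ (φ : M ≃ₗ[A] M) (ψ : N ≃ₗ[A] N),
          ab' = (ab.1 ∘ₗ ψ.symm.toLinearMap, φ.toLinearMap ∘ₗ ab.2))) := by
  exact ⟨hallP_eq_mul A M N R,
    fun _ h _ _ hψ hφ => h.comp_equiv_injective hψ hφ,
    fun _ h => h.comp_equiv,
    fun _ h => h.nonempty_equiv,
    IsSES.exists_range_eq,
    fun _ _ h h' => h.range_eq_iff h'⟩
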